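/- arXiv:math/0702451 — 3 statements merged into one kernel-verified Lean document; each statement's English description precedes it below -/
import Mathlib

section
/- Let (R, m) be a finite local commutative ring with |R| = p^n, where p is a prime and n is a positive integer, and suppose m^(n-1) ≠ 0. Then for any commutative ring S, the zero-divisor graph Γ(S × R) of the product ring S × R is isomorphic as a simple graph to the zero-divisor graph Γ(S × Z/p^n Z). -/
/-- The zero-divisor graph of a commutative ring: vertices are the nonzero zero-divisors,
with distinct vertices adjacent iff their product is zero. -/
def zeroDivisorGraph (R : Type*) [CommRing R] :
    SimpleGraph {x : R // x ≠ 0 ∧ ∃ y : R, y ≠ 0 ∧ x * y = 0} where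
  Adj u v := u ≠ v ∧ u.1 * v.1 = 0
  symm := ⟨fun u v h => ⟨h.1.symm, by rw [mul_comm]; exact h.2⟩⟩
  loopless := ⟨fun u h => h.1 rfl⟩


theorem aux_card {C : Type*} [Finite C] (k : C → ℕ) (i : ℕ) :
    Nat.card {x // i ≤ k x} = Nat.card {x // k x = i} + Nat.card {x // i + 1 ≤ k x} := by
  have e1 := Set.ncard_union_eq (s := {x | k x = i}) (t := {x | i + 1 ≤ k x})
    (by rw [Set.disjoint_left]; intro x hx hy; simp at hx hy; omega)
    (Set.toFinite _) (Set.toFinite _)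
  have e2 : {x | k x = i} ∪ {x | i + 1 ≤ k x} = {x | i ≤ k x} := by
    ext x; simp; omega
  rw [e2] at e1
  exact e1

theorem aux_fiber {A B : Type*} [Finite A] [Finite B] (n : ℕ) (f : A → ℕ) (g : B → ℕ)
    (hf : ∀ x, f x ≤ n) (hg : ∀ x, g x ≤ n)
    (h : ∀ i ≤ n, Nat.card {x // i ≤ f x} = Nat.card {x // i ≤ g x}) :
    ∃ e : A ≃ B, ∀ x, g (e x) = f x := by
  have h' : ∀ i, Nat.card {x // i ≤ f x} = Nat.card {x // i ≤ g x} := by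
    intro i
    by_cases hi : i ≤ n
    · exact h i hi
    · have : IsEmpty {x // i ≤ f x} := ⟨fun x => hi (x.2.trans (hf _))⟩
      have : IsEmpty {x // i ≤ g x} := ⟨fun x => hi (x.2.trans (hg _))⟩
      simp
  have hc : ∀ i, Nonempty ({x // f x = i} ≃ {x // g x = i}) := by
    intro i
    refine Finite.card_eq.1 ?_
    have h1 := aux_card f i
    have h2 := aux_card g i
    have h3 := h' i
    have h4 := h' (i + 1)
    omega
  exact ⟨Equiv.ofFiberEquiv (fun i => (hc i).some), fun x => Equiv.ofFiberEquiv_map _ x⟩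

theorem aux_lt {R : Type*} [CommRing R] [Finite R] {I J : Ideal R} (h : I < J) :
    Nat.card I < Nat.card J :=
  Set.ncard_lt_ncard (s := (I : Set R)) (t := (J : Set R)) h (Set.toFinite _)

theorem aux_val (p n : ℕ) (hp : p.Prime) (hn : 0 < n)
    (R : Type*) [CommRing R] [IsLocalRing R] [Finite R]
    (hcard : Nat.card R = p ^ n)
    (hm : IsLocalRing.maximalIdeal R ^ (n - 1) ≠ ⊥) :
    ∃ v : R → ℕ, (∀ x, v x ≤ n) ∧ (∀ i ≤ n, Nat.card {x // i ≤ v x} = p ^ (n - i)) ∧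
      ∀ x y, x * y = 0 ↔ n ≤ v x + v y := by
  classical
  set m := IsLocalRing.maximalIdeal R with hmdef
  have hjac : m ≤ Ideal.jacobson ⊥ := by
    rw [IsLocalRing.jacobson_eq_maximalIdeal _ bot_ne_top]
  have hpow : ∀ I : Ideal R, ∃ a, Nat.card I = p ^ a := by
    intro I
    have h := AddSubgroup.card_addSubgroup_dvd_card I.toAddSubgroup
    rw [hcard] at h
    obtain ⟨a, -, ha⟩ := (Nat.dvd_prime_pow hp).1 h
    exact ⟨a, ha⟩
  choose a ha using hpow
  have alt : ∀ {I J : Ideal R}, I < J → a I < a J := by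
    intro I J h
    have := aux_lt h
    rw [ha, ha] at this
    exact (Nat.pow_lt_pow_iff_right hp.one_lt).1 this
  have hstep : ∀ i < n, m ^ (i + 1) < m ^ i := by
    intro i hi
    refine lt_of_le_of_ne (Ideal.pow_le_pow_right (Nat.le_succ _)) fun he => ?_
    have hb : m ^ i = ⊥ := by
      refine Submodule.eq_bot_of_le_smul_of_le_jacobson_bot m (m ^ i)
        (IsNoetherian.noetherian _) ?_ hjac
      rw [smul_eq_mul, ← pow_succ', he]
    exact hm (le_bot_iff.1 ((Ideal.pow_le_pow_right (by omega)).trans hb.le))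
  have a0 : a (m ^ 0) = n := by
    have h := ha (m ^ 0)
    have h2 : Nat.card ((m ^ 0 : Ideal R)) = Nat.card R := by
      rw [pow_zero, Ideal.one_eq_top]
      exact Nat.card_congr (Equiv.Set.univ R)
    rw [h2, hcard] at h
    exact (Nat.pow_right_injective hp.two_le h).symm
  have up : ∀ i ≤ n, a (m ^ i) + i ≤ n := by
    intro i
    induction i with
    | zero => intro _; omega
    | succ i ih =>
      intro hi
      have := ih (by omega)
      have := alt (hstep i (by omega))
      omega
  have down : ∀ j ≤ n, j ≤ a (m ^ (n - j)) := by
    intro j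
    induction j with
    | zero => intro _; omega
    | succ j ih =>
      intro hj
      have h1 := ih (by omega)
      have h2 := alt (hstep (n - (j + 1)) (by omega))
      have h3 : n - (j + 1) + 1 = n - j := by omega
      rw [h3] at h2
      omega
  have aeq : ∀ i ≤ n, a (m ^ i) = n - i := by
    intro i hi
    have h1 := up i hi
    have h2 := down (n - i) (by omega)
    have h3 : n - (n - i) = i := by omega
    rw [h3] at h2
    omega
  have mn : m ^ n = ⊥ := by
    by_contra hne
    have h1 := alt (bot_lt_iff_ne_bot.2 hne)
    rw [aeq n le_rfl] at h1
    omega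
  obtain ⟨t, ht⟩ : ∃ t, m = Ideal.span {t} := by
    by_cases h1 : n = 1
    · refine ⟨0, ?_⟩
      subst h1
      simpa using mn
    · obtain ⟨t, htm, ht2⟩ := SetLike.exists_of_lt (hstep 1 (by omega))
      rw [pow_one] at htm
      refine ⟨t, le_antisymm ?_ ((Ideal.span_singleton_le_iff_mem _).2 htm)⟩
      refine Submodule.le_of_le_smul_of_le_jacobson_bot (IsNoetherian.noetherian _) hjac ?_
      rw [smul_eq_mul, ← pow_two]
      by_contra hle
      have hsup : Ideal.span {t} ⊔ m ^ 2 ≤ m :=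
        sup_le ((Ideal.span_singleton_le_iff_mem _).2 htm) (Ideal.pow_le_self two_ne_zero)
      have l1 := alt (lt_of_le_not_ge hsup hle)
      have l2 : m ^ 2 < Ideal.span {t} ⊔ m ^ 2 := by
        refine lt_of_le_not_ge le_sup_right fun hh => ht2 ?_
        exact hh (Ideal.mem_sup_left (Ideal.mem_span_singleton_self t))
      have l2 := alt l2
      have e1 := aeq 1 (by omega)
      rw [pow_one] at e1
      have e2 := aeq 2 (by omega)
      omega
  have mem : ∀ i x, x ∈ m ^ i ↔ t ^ i ∣ x := by
    intro i x
    rw [ht, Ideal.span_singleton_pow, Ideal.mem_span_singleton]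
  have t0 : ∀ k, t ^ k = 0 ↔ n ≤ k := by
    intro k
    constructor
    · intro h
      by_contra hk
      apply hm
      refine le_bot_iff.1 ((Ideal.pow_le_pow_right (show k ≤ n - 1 by omega)).trans ?_)
      rw [ht, Ideal.span_singleton_pow, h]
      simp
    · intro h
      have h2 : t ^ k ∈ m ^ n := (mem _ _).2 (pow_dvd_pow _ h)
      rwa [mn, Ideal.mem_bot] at h2
  set v : R → ℕ := fun x => Nat.findGreatest (fun k => x ∈ m ^ k) n with hv
  have vle : ∀ x, v x ≤ n := fun x => Nat.findGreatest_le n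
  have vmem : ∀ x, x ∈ m ^ (v x) := fun x =>
    Nat.findGreatest_spec (P := fun k => x ∈ m ^ k) (Nat.zero_le n) (by simp)
  have viff : ∀ i ≤ n, ∀ x, i ≤ v x ↔ x ∈ m ^ i := fun i hi x =>
    ⟨fun h => Ideal.pow_le_pow_right h (vmem x), fun h => Nat.le_findGreatest hi h⟩
  have vform : ∀ x, ∃ u, IsUnit u ∧ x = t ^ (v x) * u := by
    intro x
    obtain ⟨u, hu⟩ := (mem _ _).1 (vmem x)
    by_cases hx : v x = n
    · refine ⟨1, isUnit_one, ?_⟩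
      rw [hx, (t0 n).2 le_rfl, zero_mul] at hu
      rw [hx, (t0 n).2 le_rfl, zero_mul, hu]
    · refine ⟨u, ?_, hu⟩
      by_contra hnu
      have h1 : u ∈ m := hnu
      rw [ht, Ideal.mem_span_singleton] at h1
      have h2 : t ^ (v x + 1) ∣ x := by
        conv_rhs => rw [hu]
        rw [pow_succ]
        exact mul_dvd_mul_left _ h1
      have := vle x
      have := (viff (v x + 1) (by omega) x).2 ((mem _ _).2 h2)
      omega
  refine ⟨v, vle, ?_, ?_⟩
  · intro i hi
    rw [← aeq i hi, ← ha]
    exact Nat.card_congr (Equiv.subtypeEquivRight (viff i hi))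
  · intro x y
    obtain ⟨u, hu, hx⟩ := vform x
    obtain ⟨w, hw, hy⟩ := vform y
    rw [← t0]
    have : x * y = t ^ (v x + v y) * (u * w) := by
      conv_lhs => rw [hx, hy]
      ring
    rw [this, (hu.mul hw).mul_left_eq_zero]

theorem aux_zmod (p n : ℕ) (hp : p.Prime) (hn : 0 < n) :
    ∃ v : ZMod (p ^ n) → ℕ, (∀ x, v x ≤ n) ∧
      (∀ i ≤ n, Nat.card {x // i ≤ v x} = p ^ (n - i)) ∧
      ∀ x y, x * y = 0 ↔ n ≤ v x + v y := by
  have : Fact p.Prime := ⟨hp⟩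
  have : NeZero (p ^ n) := ⟨pow_ne_zero _ hp.ne_zero⟩
  have : Fact (1 < p ^ n) := ⟨Nat.one_lt_pow hn.ne' hp.one_lt⟩
  have : IsLocalRing (ZMod (p ^ n)) :=
    IsLocalRing.of_surjective' (PadicInt.toZModPow (p := p) n) (ZMod.ringHom_surjective _)
  refine aux_val p n hp hn _ (by simp) fun h => ?_
  have hpm : (p : ZMod (p ^ n)) ∈ IsLocalRing.maximalIdeal (ZMod (p ^ n)) := by
    rw [IsLocalRing.mem_maximalIdeal, mem_nonunits_iff, ZMod.isUnit_iff_coprime]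
    intro hc
    exact hp.one_lt.ne' (Nat.Coprime.eq_one_of_dvd hc (dvd_pow_self p hn.ne'))
  have h2 := Ideal.pow_mem_pow hpm (n - 1)
  rw [h, Ideal.mem_bot, ← Nat.cast_pow, ZMod.natCast_eq_zero_iff,
    Nat.pow_dvd_pow_iff_le_right hp.one_lt] at h2
  omega

theorem stmt5 (p n : ℕ) (hp : p.Prime) (hn : 0 < n)
    (R : Type*) [CommRing R] [IsLocalRing R] [Finite R]
    (hcard : Nat.card R = p ^ n)
    (hm : IsLocalRing.maximalIdeal R ^ (n - 1) ≠ ⊥)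
    (S : Type*) [CommRing S] :
    Nonempty (zeroDivisorGraph (S × R) ≃g zeroDivisorGraph (S × ZMod (p ^ n))) := by
  have : NeZero (p ^ n) := ⟨pow_ne_zero _ hp.ne_zero⟩
  obtain ⟨v, v1, v2, v3⟩ := aux_val p n hp hn R hcard hm
  obtain ⟨w, w1, w2, w3⟩ := aux_zmod p n hp hn
  obtain ⟨e, he⟩ := aux_fiber n v w v1 w1 (fun i hi => (v2 i hi).trans (w2 i hi).symm)
  have emul : ∀ x y, e x * e y = 0 ↔ x * y = 0 := by
    intro x y
    rw [w3, v3, he, he]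
  have e0 : ∀ x, e x = 0 ↔ x = 0 := by
    intro x
    constructor
    · intro h
      have := (emul x 1).1 (by rw [h, zero_mul])
      simpa using this
    · intro h
      have := (emul x (e.symm 1)).2 (by rw [h, zero_mul])
      simpa using this
  let E : S × R ≃ S × ZMod (p ^ n) := (Equiv.refl S).prodCongr e
  have Emul : ∀ x y, E x * E y = 0 ↔ x * y = 0 := by
    intro x y
    simp [E, Prod.ext_iff, emul]
  have E0 : ∀ x, E x = 0 ↔ x = 0 := by
    intro x
    simp [E, Prod.ext_iff, e0]
  refine ⟨⟨E.subtypeEquiv ?_, ?_⟩⟩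
  · intro x
    rw [← E.exists_congr_right]
    simp only [ne_eq, E0, Emul]
  · intro x y
    simp [zeroDivisorGraph, Emul, Subtype.ext_iff]
end

section
/- The zero-divisor graph of the ring (Z/8Z)[x]/(x^2 - 4, 2x) is isomorphic as a simple graph to the graph on seven vertices {0, 1, 2, 3, 4, 5, 6} in which vertex 0 is adjacent to each of the vertices 1 through 6, and the only other edges are {1,2}, {2,3}, {3,4}, {1,4}, and {5,6} (so the non-universal vertices induce the disjoint union of a 4-cycle and a single edge). -/
/-- The graph `G₃` on `Fin 7`: vertex `0` is adjacent to each of `1,…,6`, and the only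
other edges are `{1,2}`, `{2,3}`, `{3,4}`, `{1,4}` and `{5,6}`. -/
def graphG3 : SimpleGraph (Fin 7) :=
  SimpleGraph.fromRel
    (fun a b => (a = 0 ∧ b ≠ 0) ∨ (a = 1 ∧ b = 2) ∨ (a = 2 ∧ b = 3) ∨ (a = 3 ∧ b = 4) ∨
      (a = 1 ∧ b = 4) ∨ (a = 5 ∧ b = 6))

open Polynomial

noncomputable abbrev II : Ideal (ZMod 8)[X] :=
  Ideal.span {(X : (ZMod 8)[X]) ^ 2 - 4, 2 * (X : (ZMod 8)[X])}

noncomputable abbrev RR : Type := (ZMod 8)[X] ⧸ II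

noncomputable def ff (a b : ZMod 8) : RR := Ideal.Quotient.mk II (C a + C b * X)

lemma phi_zero (p : (ZMod 8)[X]) (hp : p ∈ II) : p.coeff 0 + 4 * p.coeff 2 = 0 := by
  obtain ⟨u, v, rfl⟩ := Ideal.mem_span_pair.1 hp
  have e : u * (X ^ 2 - 4) + v * (2 * X) = u * X ^ 2 - C 4 * u + C 2 * (v * X) := by
    have h4 : (C 4 : (ZMod 8)[X]) = 4 := rfl
    have h2 : (C 2 : (ZMod 8)[X]) = 2 := rfl
    rw [h4, h2]; ring
  rw [e]
  have h1 : (v * X).coeff 2 = v.coeff 1 := coeff_mul_X v 1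
  have h2 : (u * X ^ 2).coeff 2 = u.coeff 0 := coeff_mul_X_pow u 2 0
  have h3 : (u * X ^ 2).coeff 0 = 0 := by simp
  simp only [coeff_add, coeff_sub, coeff_C_mul, h1, h2, h3, coeff_mul_X_zero]
  generalize u.coeff 0 = a
  generalize u.coeff 2 = b
  generalize v.coeff 1 = c
  revert a b c
  decide +kernel

lemma xx : (Ideal.Quotient.mk II X) * (Ideal.Quotient.mk II X) = 4 := by
  have : Ideal.Quotient.mk II (X ^ 2 - 4) = 0 :=
    Ideal.Quotient.eq_zero_iff_mem.2 (Ideal.subset_span (by simp))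
  rw [map_sub, sub_eq_zero, map_pow, pow_two] at this
  rw [this]; rfl

lemma tx : 2 * (Ideal.Quotient.mk II X) = 0 := by
  have : Ideal.Quotient.mk II (2 * X) = 0 :=
    Ideal.Quotient.eq_zero_iff_mem.2 (Ideal.subset_span (by simp))
  rw [map_mul] at this
  exact this

lemma ff_eq (a b : ZMod 8) : ff a b =
    Ideal.Quotient.mk II (C a) + Ideal.Quotient.mk II (C b) * Ideal.Quotient.mk II X := by
  simp [ff]

lemma C4 : Ideal.Quotient.mk II (C 4) = 4 := rfl

lemma ff_mul (a b c d : ZMod 8) : ff a b * ff c d = ff (a*c + 4*(b*d)) (a*d+b*c) := by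
  simp only [ff_eq, map_add, map_mul, C4]
  linear_combination (Ideal.Quotient.mk II (C b) * Ideal.Quotient.mk II (C d)) * xx

lemma ff_sub (a b c d : ZMod 8) : ff a b - ff c d = ff (a-c) (b-d) := by
  simp only [ff_eq, map_sub]
  ring

lemma ff_add (a b c d : ZMod 8) : ff a b + ff c d = ff (a+c) (b+d) := by
  simp only [ff_eq, map_add]
  ring

lemma ff_zero (a b : ZMod 8) : ff a b = 0 ↔ a = 0 ∧ 4 * b = 0 := by
  constructor
  · intro h
    have h0 : (C a + C b * X : (ZMod 8)[X]) ∈ II := Ideal.Quotient.eq_zero_iff_mem.1 h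
    have h1 := phi_zero _ h0
    have h2 := phi_zero _ (II.mul_mem_right X h0)
    have e : (C a + C b * X : (ZMod 8)[X]) * X = C a * X + C b * X ^ 2 := by ring
    rw [e] at h2
    simp [coeff_X, coeff_C] at h1 h2
    exact ⟨h1, h2⟩
  · rintro ⟨rfl, h⟩
    have : ∃ c, b = 2 * c := by revert b; decide
    obtain ⟨c, rfl⟩ := this
    have h2 : Ideal.Quotient.mk II (C 2) = 2 := rfl
    simp only [ff_eq, map_mul, map_zero, h2]
    linear_combination (Ideal.Quotient.mk II (C c)) * tx

lemma ff_inj (a b c d : ZMod 8) : ff a b = ff c d ↔ a - c = 0 ∧ 4 * (b - d) = 0 := by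
  rw [← sub_eq_zero, ff_sub, ff_zero]

lemma ff_surj (r : RR) : ∃ a b, ff a b = r := by
  obtain ⟨p, rfl⟩ := Ideal.Quotient.mk_surjective r
  induction p using Polynomial.induction_on' with
  | add p q hp hq =>
    obtain ⟨a, b, h⟩ := hp
    obtain ⟨c, d, h'⟩ := hq
    exact ⟨a + c, b + d, by rw [map_add, ← h, ← h', ff_add]⟩
  | monomial n a =>
    rw [← C_mul_X_pow_eq_monomial]
    induction n with
    | zero => exact ⟨a, 0, by simp [ff]⟩
    | succ n ih =>
      obtain ⟨c, d, h⟩ := ih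
      have hX : Ideal.Quotient.mk II X = ff 0 1 := by simp [ff]
      rw [pow_succ, ← mul_assoc, map_mul, ← h, hX, ff_mul]
      exact ⟨_, _, rfl⟩

def vv : Fin 7 → ZMod 8 × ZMod 8 :=
  ![(4,0),(2,0),(0,1),(6,0),(4,1),(2,1),(6,1)]

lemma vv_nz : ∀ i, ¬ ((vv i).1 = 0 ∧ 4 * (vv i).2 = 0) := by decide +kernel

lemma vv_four : ∀ i, (vv i).1 * 4 + 4 * ((vv i).2 * 0) = 0 ∧
    4 * ((vv i).1 * 0 + (vv i).2 * 4) = 0 := by decide +kernel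

lemma vv_inj : ∀ i j, (vv i).1 - (vv j).1 = 0 ∧ 4 * ((vv i).2 - (vv j).2) = 0 → i = j := by
  decide +kernel

lemma vv_adj : ∀ i j, (i ≠ j ∧ ((vv i).1 * (vv j).1 + 4 * ((vv i).2 * (vv j).2) = 0 ∧
    4 * ((vv i).1 * (vv j).2 + (vv i).2 * (vv j).1) = 0)) ↔
    (i ≠ j ∧ (((i = 0 ∧ j ≠ 0) ∨ (i = 1 ∧ j = 2) ∨ (i = 2 ∧ j = 3) ∨ (i = 3 ∧ j = 4) ∨
      (i = 1 ∧ j = 4) ∨ (i = 5 ∧ j = 6)) ∨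
      ((j = 0 ∧ i ≠ 0) ∨ (j = 1 ∧ i = 2) ∨ (j = 2 ∧ i = 3) ∨ (j = 3 ∧ i = 4) ∨
      (j = 1 ∧ i = 4) ∨ (j = 5 ∧ i = 6)))) := by
  decide +kernel

lemma vv_surj : ∀ a b : ZMod 8, ¬ (a = 0 ∧ 4 * b = 0) →
    (∃ c d : ZMod 8, ¬ (c = 0 ∧ 4 * d = 0) ∧ (a * c + 4 * (b * d) = 0 ∧
      4 * (a * d + b * c) = 0)) →
    ∃ i, (vv i).1 - a = 0 ∧ 4 * ((vv i).2 - b) = 0 := by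
  decide +kernel

noncomputable def gg (i : Fin 7) : {x : RR // x ≠ 0 ∧ ∃ y : RR, y ≠ 0 ∧ x * y = 0} :=
  ⟨ff (vv i).1 (vv i).2, fun h => vv_nz i ((ff_zero _ _).1 h), ff 4 0,
    fun h => absurd ((ff_zero _ _).1 h).1 (by decide),
    by rw [ff_mul, ff_zero]; exact vv_four i⟩

lemma gg_inj : Function.Injective gg := by
  intro i j h
  exact vv_inj i j ((ff_inj _ _ _ _).1 (congrArg Subtype.val h))

lemma gg_surj : Function.Surjective gg := by
  rintro ⟨x, hx, y, hy, hxy⟩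
  obtain ⟨a, b, rfl⟩ := ff_surj x
  obtain ⟨c, d, rfl⟩ := ff_surj y
  rw [ff_mul, ff_zero] at hxy
  rw [Ne, ff_zero] at hx hy
  obtain ⟨i, hi⟩ := vv_surj a b hx ⟨c, d, hy, hxy⟩
  exact ⟨i, Subtype.ext ((ff_inj _ _ _ _).2 hi)⟩

/-- `Γ((ZMod 8)[x]/(x^2 - 4, 2x))` is isomorphic to the graph on seven
vertices in which vertex `0` is adjacent to each of `1,…,6`, and the only other edges are
`{1,2}`, `{2,3}`, `{3,4}`, `{1,4}` and `{5,6}`. -/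
theorem stmt12 :
    Nonempty (zeroDivisorGraph
      ((ZMod 8)[X] ⧸ Ideal.span {(X : (ZMod 8)[X]) ^ 2 - 4, 2 * (X : (ZMod 8)[X])}) ≃g
      graphG3) := by
  refine ⟨RelIso.symm ⟨Equiv.ofBijective gg ⟨gg_inj, gg_surj⟩, ?_⟩⟩
  intro i j
  change (gg i ≠ gg j ∧ ff (vv i).1 (vv i).2 * ff (vv j).1 (vv j).2 = 0) ↔ graphG3.Adj i j
  rw [gg_inj.ne_iff, ff_mul, ff_zero, vv_adj, graphG3, SimpleGraph.fromRel_adj]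
end

section
/- Let (R, m) be a finite local commutative ring with |R| = 27 such that m^2 ≠ 0. If the characteristic of R is 9, then R is isomorphic as a ring to (Z/9Z)[x]/(x^3, x^2 - 3) or to (Z/9Z)[x]/(x^3, x^2 + 3). -/
open Polynomial

lemma aux_card_lt {R : Type*} [CommRing R] [Finite R] {I J : Ideal R} (h : I < J) :
    Nat.card I ∣ Nat.card J ∧ Nat.card I < Nat.card J := by
  refine ⟨AddSubgroup.card_dvd_of_le (H := I.toAddSubgroup) (K := J.toAddSubgroup) h.le, ?_⟩
  exact Set.ncard_lt_ncard (s := (I : Set R)) (t := (J : Set R)) h (Set.toFinite _)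

lemma aux_pow_lt {R : Type*} [CommRing R] [IsLocalRing R] [Finite R] (n : ℕ)
    (h : IsLocalRing.maximalIdeal R ^ n ≠ ⊥) :
    IsLocalRing.maximalIdeal R ^ (n+1) < IsLocalRing.maximalIdeal R ^ n := by
  refine lt_of_le_of_ne (Ideal.pow_le_pow_right (Nat.le_succ n)) fun he => h ?_
  refine Submodule.eq_bot_of_le_smul_of_le_jacobson_bot (IsLocalRing.maximalIdeal R) _
    (IsNoetherian.noetherian _) ?_ (IsLocalRing.maximalIdeal_le_jacobson _)
  rw [smul_eq_mul, ← pow_succ', he]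

lemma aux_cards {R : Type*} [CommRing R] [IsLocalRing R] [Finite R]
    (hcard : Nat.card R = 27)
    (hm : IsLocalRing.maximalIdeal R ^ 2 ≠ ⊥) :
    Nat.card (IsLocalRing.maximalIdeal R) = 9 ∧
    Nat.card (IsLocalRing.maximalIdeal R ^ 2 : Ideal R) = 3 ∧
    IsLocalRing.maximalIdeal R ^ 3 = ⊥ := by
  have hm1 : IsLocalRing.maximalIdeal R ^ 1 ≠ ⊥ := by
    intro h; apply hm; rw [pow_succ, h]; simp
  have h2 := aux_card_lt (aux_pow_lt 2 hm)
  have h1 := aux_card_lt (aux_pow_lt 1 hm1)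
  have h0 := aux_card_lt (lt_top_iff_ne_top.2 (IsLocalRing.maximalIdeal.isMaximal R).ne_top)
  have ht : Nat.card (⊤ : Ideal R) = 27 := by
    rw [← hcard]; exact Nat.card_congr (Equiv.Set.univ R)
  rw [ht] at h0
  norm_num at h1 h2
  have hp : 0 < Nat.card (IsLocalRing.maximalIdeal R ^ 3 : Ideal R) := Nat.card_pos
  have key : ∀ a < 27, a ∣ 27 → ∀ b < a, b ∣ a → ∀ c < b, c ∣ b → 0 < c →
    a = 9 ∧ b = 3 ∧ c = 1 := by
    intro a ha hd b hb hbd c hc hcd h0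
    have k1 : ∀ a < 27, a ∣ 27 → a = 1 ∨ a = 3 ∨ a = 9 := by decide
    have k2 : ∀ b < 9, b ∣ 9 → b = 1 ∨ b = 3 := by decide
    have k3 : ∀ c < 3, c ∣ 3 → c = 1 := by decide
    rcases k1 a ha hd with rfl | rfl | rfl
    · omega
    · have := k3 b hb hbd
      omega
    · rcases k2 b hb hbd with rfl | rfl
      · omega
      · exact ⟨rfl, rfl, k3 c hc hcd⟩
  obtain ⟨ha, hb, hc⟩ := key _ h0.2 h0.1 _ h1.2 h1.1 _ h2.2 h2.1 hp
  refine ⟨ha, hb, ?_⟩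
  have := (Nat.card_eq_one_iff_unique.1 hc).1
  exact (Submodule.subsingleton_iff_eq_bot).1 this

lemma aux_sq_ne {R : Type*} [CommRing R] [IsLocalRing R] [Finite R]
    (hcard : Nat.card R = 27)
    (hm : IsLocalRing.maximalIdeal R ^ 2 ≠ ⊥) {y : R} (hy : y ∈ IsLocalRing.maximalIdeal R)
    (hy2 : y ∉ IsLocalRing.maximalIdeal R ^ 2) : y ^ 2 ≠ 0 := by
  intro h0
  obtain ⟨c1, c2, h3⟩ := aux_cards hcard hm
  set m := IsLocalRing.maximalIdeal R with hmdef
  have hle : m ^ 2 ⊔ Ideal.span {y} ≤ m :=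
    sup_le (Ideal.pow_le_self two_ne_zero) ((Ideal.span_singleton_le_iff_mem _).2 hy)
  have hlt : m ^ 2 < m ^ 2 ⊔ Ideal.span {y} := by
    refine lt_of_le_of_ne le_sup_left fun h => hy2 ?_
    rw [h]; exact Ideal.mem_sup_right (Ideal.mem_span_singleton_self y)
  have heq : m ^ 2 ⊔ Ideal.span {y} = m := by
    by_contra hne
    have a := aux_card_lt hlt
    have b := aux_card_lt (lt_of_le_of_ne hle hne)
    rw [c1] at b
    rw [c2] at a
    have key : ∀ k < 9, k ∣ 9 → 3 < k → False := by decide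
    exact key _ b.2 b.1 a.2
  apply hm
  rw [eq_bot_iff, pow_two, Ideal.mul_le]
  have hz : ∀ u ∈ m ^ 2, ∀ v ∈ m, u * v = 0 := by
    intro u hu v hv
    have : u * v ∈ m ^ 3 := by rw [pow_succ m 2]; exact Ideal.mul_mem_mul hu hv
    rwa [h3] at this
  have hd : ∀ u ∈ m, ∃ z ∈ m ^ 2, ∃ r, u = z + r * y := by
    intro u hu
    rw [← heq] at hu
    obtain ⟨z, hz, w, hw, rfl⟩ := Submodule.mem_sup.1 hu
    obtain ⟨r, rfl⟩ := Ideal.mem_span_singleton'.1 hw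
    exact ⟨z, hz, r, rfl⟩
  intro u hu v hv
  obtain ⟨z, hz1, r, rfl⟩ := hd u hu
  obtain ⟨z', hz1', r', rfl⟩ := hd v hv
  have e1 := hz z hz1 _ hv
  have e2 := hz z' hz1' y hy
  change _ = 0
  linear_combination e1 + r * e2 + r * r' * h0

lemma aux_iso {R : Type*} [CommRing R] [IsLocalRing R] [Finite R]
    (hcard : Nat.card R = 27) (hchar : CharP R 9) (c : ZMod 9) (hc : c = 3 ∨ c = -3)
    (x : R) (hx : x ∈ IsLocalRing.maximalIdeal R)
    (hx2 : x ∉ IsLocalRing.maximalIdeal R ^ 2)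
    (h3 : (3 : R) ∈ IsLocalRing.maximalIdeal R ^ 2)
    (hx3 : x ^ 3 = 0) (h3x : 3 * x = 0) (hxc : x ^ 2 = ZMod.castHom (dvd_refl 9) R c)
    (I : Ideal (ZMod 9)[X]) (hI : I = Ideal.span {(X : (ZMod 9)[X]) ^ 3, X ^ 2 - C c}) :
    Nonempty (R ≃+* ((ZMod 9)[X] ⧸ I)) := by
  set f := ZMod.castHom (dvd_refl 9) R with hf
  have hfinj : Function.Injective f := ZMod.castHom_injective R
  have : Nontrivial (ZMod 9) := ⟨0, 1, by decide⟩
  set m := IsLocalRing.maximalIdeal R with hmdef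
  have h3m : (3 : R) ∈ m := Ideal.pow_le_self two_ne_zero h3
  have hnm : (1 : R) ∉ m := (Ideal.ne_top_iff_one _).1 (IsLocalRing.maximalIdeal.isMaximal R).ne_top
  -- elements of the prime ring in m are multiples of 3
  have hdiv : ∀ a : ZMod 9, f a ∈ m → ∃ b, a = 3 * b := by
    intro a ha
    by_contra hcon
    have key : ∀ a : ZMod 9, (¬ ∃ b, a = 3 * b) → ∃ d, d * a = 1 := by decide
    obtain ⟨d, hd⟩ := key a hcon
    apply hnm
    rw [← map_one f, ← hd, map_mul]
    exact m.mul_mem_left _ ha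
  have hf3 : f 3 = 3 := map_ofNat f 3
  have hdiv2 : ∀ a : ZMod 9, f a ∈ m → f a ∈ m ^ 2 := by
    intro a ha
    obtain ⟨b, rfl⟩ := hdiv a ha
    rw [map_mul, hf3]
    exact (m^2).mul_mem_right _ h3
  set φ : (ZMod 9)[X] →+* R := eval₂RingHom f x with hφ
  have hφX : φ X = x := by simp [hφ]
  have hφC : ∀ a, φ (C a) = f a := by simp [hφ]
  have hker : ∀ p ∈ I, φ p = 0 := by
    have : I ≤ RingHom.ker φ := by
      rw [hI, Ideal.span_le]
      rintro p (rfl | rfl)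
      · change φ _ = 0
        rw [map_pow, hφX, hx3]
      · change φ _ = 0
        rw [map_sub, map_pow, hφX, hφC, hxc, sub_self]
    exact fun p hp => this hp
  have hIX3 : (X : (ZMod 9)[X]) ^ 3 ∈ I := by rw [hI]; exact Ideal.subset_span (by simp)
  have hIX2 : (X : (ZMod 9)[X]) ^ 2 - C c ∈ I := by rw [hI]; exact Ideal.subset_span (by simp)
  have hI3X : C 3 * (X : (ZMod 9)[X]) ∈ I := by
    have h : C c * (X : (ZMod 9)[X]) ∈ I := by
      have := I.sub_mem hIX3 (I.mul_mem_left X hIX2)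
      convert this using 1; ring
    rcases hc with rfl | rfl
    · exact h
    · have := I.neg_mem h
      convert this using 1; simp
  have hinj : ∀ p, φ p = 0 → p ∈ I := by
    intro p hp
    have hmon : (X ^ 2 - C c : (ZMod 9)[X]).Monic := monic_X_pow_sub_C c two_ne_zero
    have hdm := modByMonic_add_div p (X ^ 2 - C c)
    have hdeg : (p %ₘ (X ^ 2 - C c)).natDegree ≤ 1 := by
      have := natDegree_modByMonic_lt p hmon (by
        intro h
        have := congrArg natDegree h
        rw [natDegree_X_pow_sub_C] at this
        simp at this)
      rw [natDegree_X_pow_sub_C] at this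
      omega
    obtain ⟨b, a, hab⟩ := exists_eq_X_add_C_of_natDegree_le_one hdeg
    have hq : (X ^ 2 - C c) * (p /ₘ (X ^ 2 - C c)) ∈ I := I.mul_mem_right _ hIX2
    have h0 : f b * x + f a = 0 := by
      rw [← hdm, map_add, hker _ hq, hab, add_zero, map_add, map_mul, hφC, hφC, hφX] at hp
      exact hp
    have ham : f a ∈ m := by
      have : f a = -(f b * x) := by linear_combination h0
      rw [this]; exact m.neg_mem (m.mul_mem_left _ hx)
    have ha2 := hdiv2 a ham
    have hb : f b ∈ m := by
      by_contra hb
      have hu : IsUnit (f b) := by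
        by_contra h; exact hb ((IsLocalRing.mem_maximalIdeal _).2 h)
      obtain ⟨d, hd⟩ := hu.exists_left_inv
      apply hx2
      have : x = -d * f a := by linear_combination d * h0 - x * hd
      rw [this]; exact (m^2).mul_mem_left _ ha2
    obtain ⟨b', rfl⟩ := hdiv b hb
    have ha : a = 0 := by
      apply hfinj
      rw [map_zero]
      rw [map_mul, hf3] at h0
      linear_combination h0 - f b' * h3x
    rw [← hdm, hab, ha]
    refine I.add_mem ?_ hq
    have := I.mul_mem_left (C b') hI3X
    convert this using 1
    simp only [C_mul, C_0]; ring
  have hsurj : Function.Surjective φ := by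
    have hd : Nat.card φ.range ∣ 27 := by
      rw [← hcard]; exact AddSubgroup.card_addSubgroup_dvd_card φ.range.toAddSubgroup
    have hlt : 9 < Nat.card φ.range := by
      have h9 : (Set.range f).ncard = 9 := by
        rw [← Set.image_univ, Set.ncard_image_of_injective _ hfinj, Set.ncard_univ]; simp
      have : (Set.range f).ncard < ((φ.range : Subring R) : Set R).ncard := by
        apply Set.ncard_lt_ncard _ (Set.toFinite _)
        refine ⟨?_, fun h => ?_⟩
        · rintro _ ⟨a, rfl⟩; exact ⟨C a, hφC a⟩
        · obtain ⟨a, ha⟩ := h ⟨X, hφX⟩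
          apply hx2
          rw [← ha]; apply hdiv2; rw [ha]; exact hx
      rw [h9] at this
      exact this
    have h27 : Nat.card φ.range = 27 := by
      have := Nat.le_of_dvd (by norm_num) hd
      generalize Nat.card φ.range = k at *
      have key : ∀ k ≤ 27, k ∣ 27 → 9 < k → k = 27 := by decide
      exact key k this hd hlt
    have : ((φ.range : Subring R) : Set R) = Set.univ :=
      Set.eq_of_subset_of_ncard_le (Set.subset_univ _)
        (by rw [Set.ncard_univ, hcard]; exact h27.ge) (Set.toFinite _)
    intro r
    have hr : r ∈ ((φ.range : Subring R) : Set R) := by rw [this]; trivial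
    exact hr
  have hk : I = RingHom.ker φ := le_antisymm (fun p hp => hker p hp) (fun p hp => hinj p hp)
  exact ⟨((Ideal.quotEquivOfEq hk).trans (RingHom.quotientKerEquivOfSurjective hsurj)).symm⟩

theorem stmt19 (R : Type*) [CommRing R] [IsLocalRing R] [Finite R]
    (hcard : Nat.card R = 27)
    (hm : IsLocalRing.maximalIdeal R ^ 2 ≠ ⊥)
    (hchar : ringChar R = 9) :
    Nonempty (R ≃+*
      ((ZMod 9)[X] ⧸ Ideal.span {(X : (ZMod 9)[X]) ^ 3, (X : (ZMod 9)[X]) ^ 2 - 3})) ∨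
    Nonempty (R ≃+*
      ((ZMod 9)[X] ⧸ Ideal.span {(X : (ZMod 9)[X]) ^ 3, (X : (ZMod 9)[X]) ^ 2 + 3})) := by
  have hch : CharP R 9 := ringChar.of_eq hchar
  obtain ⟨c1, c2, hm3⟩ := aux_cards hcard hm
  have h9 : (9 : R) = 0 := by exact_mod_cast CharP.cast_eq_zero R 9
  have h30 : (3 : R) ≠ 0 := by
    intro h
    have := (CharP.cast_eq_zero_iff R 9 3).1 (by exact_mod_cast h)
    norm_num at this
  have h60 : (6 : R) ≠ 0 := by
    intro h
    have := (CharP.cast_eq_zero_iff R 9 6).1 (by exact_mod_cast h)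
    norm_num at this
  have h3m : (3 : R) ∈ IsLocalRing.maximalIdeal R := by
    rw [IsLocalRing.mem_maximalIdeal]
    intro hu
    have h33 : (3 : R) * 3 = 0 := by linear_combination h9
    exact h30 ((hu.mul_right_eq_zero).1 h33)
  have h3 : (3 : R) ∈ IsLocalRing.maximalIdeal R ^ 2 := by
    by_contra h
    exact aux_sq_ne hcard hm h3m h (by linear_combination h9)
  obtain ⟨x, hx, hx2⟩ : ∃ x ∈ IsLocalRing.maximalIdeal R, x ∉ IsLocalRing.maximalIdeal R ^ 2 := by
    by_contra! hcon
    have : IsLocalRing.maximalIdeal R ^ 2 = IsLocalRing.maximalIdeal R :=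
      le_antisymm (Ideal.pow_le_self two_ne_zero) hcon
    rw [this] at c2
    omega
  have hxsq := aux_sq_ne hcard hm hx hx2
  have hxm2 : x ^ 2 ∈ IsLocalRing.maximalIdeal R ^ 2 := Ideal.pow_mem_pow hx 2
  have hx3 : x ^ 3 = 0 := by
    have := Ideal.pow_mem_pow hx 3
    rwa [hm3] at this
  have h3x : 3 * x = 0 := by
    have : 3 * x ∈ IsLocalRing.maximalIdeal R ^ 3 := by
      rw [pow_succ _ 2]; exact Ideal.mul_mem_mul h3 hx
    rwa [hm3] at this
  have hset : ({0, 3, -3} : Set R) = (IsLocalRing.maximalIdeal R ^ 2 : Ideal R) := by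
    apply Set.eq_of_subset_of_ncard_le _ _ (Set.toFinite _)
    · rintro _ (rfl | rfl | rfl)
      · exact Ideal.zero_mem _
      · exact h3
      · exact neg_mem h3
    · have : ({0, 3, -3} : Set R).ncard = 3 := by
        rw [Set.ncard_eq_three]
        refine ⟨0, 3, -3, h30.symm, ?_, ?_, rfl⟩
        · intro h; apply h30; linear_combination h
        · intro h; apply h60; linear_combination h
      rw [this]
      exact c2.le
  have hmem : x ^ 2 ∈ ({0, 3, -3} : Set R) := by rw [hset]; exact hxm2
  rcases hmem with h | h | h
  · exact absurd h hxsq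
  · left
    refine aux_iso hcard hch 3 (Or.inl rfl) x hx hx2 h3 hx3 h3x ?_ _ ?_
    · rw [h, map_ofNat]
    · rfl
  · right
    refine aux_iso hcard hch (-3) (Or.inr rfl) x hx hx2 h3 hx3 h3x ?_ _ ?_
    · rw [h, map_neg, map_ofNat]
    · rw [C_neg, sub_neg_eq_add]; rfl
end
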